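/- arXiv:math/0306084 — 4 statements merged into one kernel-verified Lean document; each statement's English description precedes it below -/
import Mathlib

section
/- (Theorem 1, relations rt-6 and rt-7 for the symmetrized generators.) The elements A†_i(k) = (1/2)(a†_i(k)+α†_i(k)) satisfy, for all k₁,k₂ ∈ ℝ and indices i,l,j: t_{il}(k₁)A†_j(k₂) = Σ_{p,q,r,s} A†_p(k₂)[S₁₂(k₁,k₂)]^{(i,p)}_{(q,r)} t_{qs}(k₁)[S₂₁(k₂,k₁)]^{(s,r)}_{(l,j)}, and r_{il}(k₁)A†_j(k₂) = Σ_{p,q,r,s} A†_p(k₂)[S₁₂(k₁,k₂)]^{(i,p)}_{(q,r)} r_{qs}(k₁)[S₂₁(k₂,−k₁)]^{(s,r)}_{(l,j)}. -/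
open scoped Matrix BigOperators

variable {n : ℕ}

/-- `[S₂₁(k₂,k₁)]^{(i,j)}_{(p,q)} = [S(k₂,k₁)]^{(j,i)}_{(q,p)}`. -/
def S21 (S : ℝ → ℝ → Matrix (Fin n × Fin n) (Fin n × Fin n) ℂ) (k₂ k₁ : ℝ) :
    Matrix (Fin n × Fin n) (Fin n × Fin n) ℂ :=
  Matrix.of fun x y => S k₂ k₁ (x.2, x.1) (y.2, y.1)

/-- `M₁ = M ⊗ Iₙ`. -/
def leg1 {A : Type*} [Semiring A] [DecidableEq (Fin n)]
    (M : Matrix (Fin n) (Fin n) A) :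
    Matrix (Fin n × Fin n) (Fin n × Fin n) A :=
  Matrix.of fun x y => if x.2 = y.2 then M x.1 y.1 else 0

/-- `M₂ = Iₙ ⊗ M`. -/
def leg2 {A : Type*} [Semiring A] [DecidableEq (Fin n)]
    (M : Matrix (Fin n) (Fin n) A) :
    Matrix (Fin n × Fin n) (Fin n × Fin n) A :=
  Matrix.of fun x y => if x.1 = y.1 then M x.2 y.2 else 0

/-- entrywise embedding of a scalar `n² × n²` matrix into matrices over `𝒜`. -/
def emb (𝒜 : Type*) [Ring 𝒜] [Algebra ℂ 𝒜]
    (M : Matrix (Fin n × Fin n) (Fin n × Fin n) ℂ) :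
    Matrix (Fin n × Fin n) (Fin n × Fin n) 𝒜 :=
  M.map (algebraMap ℂ 𝒜)

/-- entrywise embedding of a scalar `n × n` matrix into matrices over `𝒜`. -/
def embn (𝒜 : Type*) [Ring 𝒜] [Algebra ℂ 𝒜] (M : Matrix (Fin n) (Fin n) ℂ) :
    Matrix (Fin n) (Fin n) 𝒜 :=
  M.map (algebraMap ℂ 𝒜)

/-- `W₁₂` acting on factors 1,2 of `(ℂⁿ)^{⊗3}`. -/
def leg12 (W : Matrix (Fin n × Fin n) (Fin n × Fin n) ℂ) :
    Matrix (Fin n × Fin n × Fin n) (Fin n × Fin n × Fin n) ℂ :=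
  Matrix.of fun x y => if x.2.2 = y.2.2 then W (x.1, x.2.1) (y.1, y.2.1) else 0

/-- `W₁₃` acting on factors 1,3 of `(ℂⁿ)^{⊗3}`. -/
def leg13 (W : Matrix (Fin n × Fin n) (Fin n × Fin n) ℂ) :
    Matrix (Fin n × Fin n × Fin n) (Fin n × Fin n × Fin n) ℂ :=
  Matrix.of fun x y => if x.2.1 = y.2.1 then W (x.1, x.2.2) (y.1, y.2.2) else 0

/-- `W₂₃` acting on factors 2,3 of `(ℂⁿ)^{⊗3}`. -/
def leg23 (W : Matrix (Fin n × Fin n) (Fin n × Fin n) ℂ) :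
    Matrix (Fin n × Fin n × Fin n) (Fin n × Fin n × Fin n) ℂ :=
  Matrix.of fun x y => if x.1 = y.1 then W (x.2.1, x.2.2) (y.2.1, y.2.2) else 0

/-- The row-vector-valued matrix `Iₙ ⊗ v`. -/
def legRow {A : Type*} [Semiring A] (v : Fin n → A) : Matrix (Fin n) (Fin n × Fin n) A :=
  Matrix.of fun i y => if i = y.1 then v y.2 else 0

theorem legRow_add {A : Type*} [Semiring A] (v w : Fin n → A) :
    legRow (v + w) = legRow v + legRow w := by
  ext i y
  by_cases h : i = y.1 <;> simp [legRow, h]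

theorem legRow_smul {A : Type*} [Ring A] [Algebra ℂ A] (c : ℂ) (v : Fin n → A) :
    legRow (c • v) = c • legRow v := by
  ext i y
  by_cases h : i = y.1 <;> simp [legRow, h]

theorem legRow_vecMul {A : Type*} [Semiring A] (v : Fin n → A) (M : Matrix (Fin n) (Fin n) A) :
    legRow (v ᵥ* M) = legRow v * leg2 M := by
  ext i y
  by_cases h : i = y.1 <;>
    simp [legRow, leg2, Matrix.mul_apply, Fintype.sum_prod_type, Matrix.vecMul, dotProduct, h]

theorem exchange_iff {A : Type*} [Ring A] [Algebra ℂ A] (X : Matrix (Fin n) (Fin n) A)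
    (P Q : Matrix (Fin n × Fin n) (Fin n × Fin n) ℂ) (v : Fin n → A) :
    (∀ i l j, X i l * v j =
      ∑ p, ∑ q, ∑ r, ∑ s, (P (i, p) (q, r) * Q (s, r) (l, j)) • (v p * X q s)) ↔
    X * legRow v = legRow v * (emb A P * leg1 X * emb A Q) := by
  have hl (i l j : Fin n) : (X * legRow v) i (l, j) = X i l * v j := by
    simp [legRow, Matrix.mul_apply]
  have hr (i l j : Fin n) : (legRow v * (emb A P * leg1 X * emb A Q)) i (l, j) =
      ∑ p, ∑ q, ∑ r, ∑ s, (P (i, p) (q, r) * Q (s, r) (l, j)) • (v p * X q s) := by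
    have hm (p : Fin n) : (emb A P * leg1 X * emb A Q) (i, p) (l, j) =
        ∑ q, ∑ r, ∑ s, (P (i, p) (q, r) * Q (s, r) (l, j)) • X q s := by
      simp only [emb, leg1, Matrix.mul_apply, Fintype.sum_prod_type, Matrix.map_apply,
        Matrix.of_apply, mul_ite, mul_zero, Finset.sum_ite_eq', Finset.mem_univ, if_true,
        Finset.sum_mul]
      rw [Finset.sum_comm_cycle]
      refine Finset.sum_congr rfl fun q _ => ?_
      rw [Finset.sum_comm]
      refine Finset.sum_congr rfl fun r _ => Finset.sum_congr rfl fun s _ => ?_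
      rw [← Algebra.commutes, ← mul_assoc, ← map_mul, Algebra.smul_def, mul_comm]
    rw [Matrix.mul_apply, Fintype.sum_prod_type]
    simp only [legRow, Matrix.of_apply, ite_mul, zero_mul]
    rw [Finset.sum_eq_single i (by intro b _ hb; simp [hb.symm]) (by simp)]
    simp only [if_true, hm, Finset.mul_sum, mul_smul_comm]
  constructor
  · intro h
    ext i ⟨l, j⟩
    rw [hl, hr, h]
  · intro h i l j
    rw [← hl, ← hr, h]

theorem exchange_symmetrized {A : Type*} [Ring A] [Algebra ℂ A]
    {X T U : Matrix (Fin n) (Fin n) A} {M N : Matrix (Fin n × Fin n) (Fin n × Fin n) A}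
    {v w : Fin n → A} (hv : X * legRow v = legRow v * M) (hw : X * legRow w = legRow w * N)
    (hT : M * leg2 T = leg2 T * M) (hU : N * leg2 U = leg2 U * M) (c : ℂ) :
    X * legRow (c • (v + (v ᵥ* T + w ᵥ* U))) = legRow (c • (v + (v ᵥ* T + w ᵥ* U))) * M := by
  simp only [legRow_smul, legRow_add, legRow_vecMul, Matrix.mul_smul, Matrix.smul_mul,
    Matrix.mul_add, Matrix.add_mul]
  rw [← Matrix.mul_assoc X, ← Matrix.mul_assoc X, hv, hw, Matrix.mul_assoc _ M, hT,
    Matrix.mul_assoc _ N, hU, Matrix.mul_assoc, Matrix.mul_assoc]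

theorem emb_mul {A : Type*} [Ring A] [Algebra ℂ A]
    (P Q : Matrix (Fin n × Fin n) (Fin n × Fin n) ℂ) : emb A (P * Q) = emb A P * emb A Q :=
  Matrix.map_mul

theorem emb_one {A : Type*} [Ring A] [Algebra ℂ A] :
    emb A (1 : Matrix (Fin n × Fin n) (Fin n × Fin n) ℂ) = 1 :=
  Matrix.map_one _ (map_zero _) (map_one _)

theorem leg1_submatrix_swap {A : Type*} [Semiring A] (M : Matrix (Fin n) (Fin n) A) :
    (leg1 M).submatrix Prod.swap Prod.swap = leg2 M := rfl

theorem leg2_submatrix_swap {A : Type*} [Semiring A] (M : Matrix (Fin n) (Fin n) A) :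
    (leg2 M).submatrix Prod.swap Prod.swap = leg1 M := rfl

theorem emb_submatrix_swap {A : Type*} [Ring A] [Algebra ℂ A]
    (S : ℝ → ℝ → Matrix (Fin n × Fin n) (Fin n × Fin n) ℂ) (k₁ k₂ : ℝ) :
    (emb A (S k₁ k₂)).submatrix Prod.swap Prod.swap = emb A (S21 S k₁ k₂) := rfl

theorem S21_S21 (S : ℝ → ℝ → Matrix (Fin n × Fin n) (Fin n × Fin n) ℂ) : S21 (S21 S) = S := rfl

theorem submatrix_swap_mul {A : Type*} [Semiring A]
    (M N : Matrix (Fin n × Fin n) (Fin n × Fin n) A) :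
    (M * N).submatrix Prod.swap Prod.swap =
      M.submatrix Prod.swap Prod.swap * N.submatrix Prod.swap Prod.swap :=
  (Matrix.submatrix_mul_equiv M N Prod.swap (Equiv.prodComm _ _) Prod.swap).symm

/-- The exchange relation between `r` in the first leg and `t` in the second, obtained from the one
between `t` in the first leg and `r` in the second by flipping the legs and using unitarity. -/
theorem reflection_transmission_exchange {A : Type*} [Ring A] [Algebra ℂ A]
    {S : ℝ → ℝ → Matrix (Fin n × Fin n) (Fin n × Fin n) ℂ}
    (hU : ∀ k₁ k₂, S k₁ k₂ * S21 S k₂ k₁ = 1) {t r : ℝ → Matrix (Fin n) (Fin n) A}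
    (h : ∀ k₁ k₂,
      emb A (S k₁ k₂) * leg1 (t k₁) * emb A (S21 S k₂ k₁) * leg2 (r k₂) =
        leg2 (r k₂) * emb A (S k₁ (-k₂)) * leg1 (t k₁) * emb A (S21 S (-k₂) k₁)) (k₁ k₂ : ℝ) :
    emb A (S k₁ k₂) * leg1 (r k₁) * emb A (S21 S k₂ (-k₁)) * leg2 (t k₂) =
      leg2 (t k₂) * (emb A (S k₁ k₂) * leg1 (r k₁) * emb A (S21 S k₂ (-k₁))) := by
  have unit (k₁ k₂ : ℝ) : emb A (S k₁ k₂) * emb A (S21 S k₂ k₁) = 1 := by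
    rw [← emb_mul, hU, emb_one]
  have flip := congrArg (Matrix.submatrix · Prod.swap Prod.swap) (h k₂ k₁)
  simp only [submatrix_swap_mul, emb_submatrix_swap, S21_S21,
    leg1_submatrix_swap, leg2_submatrix_swap] at flip
  calc
    _ = emb A (S k₁ k₂) * (leg1 (r k₁) * emb A (S21 S k₂ (-k₁)) * leg2 (t k₂) *
          emb A (S (-k₁) k₂)) * emb A (S21 S k₂ (-k₁)) := by
      simp only [Matrix.mul_assoc, unit, Matrix.mul_one]
    _ = (emb A (S k₁ k₂) * emb A (S21 S k₂ k₁)) * leg2 (t k₂) * emb A (S k₁ k₂) *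
          leg1 (r k₁) * emb A (S21 S k₂ (-k₁)) := by
      rw [← flip]
      simp only [Matrix.mul_assoc]
    _ = _ := by
      rw [unit, Matrix.one_mul]
      simp only [Matrix.mul_assoc]

theorem stmt_15
    (hn : 1 ≤ n)
    (S : ℝ → ℝ → Matrix (Fin n × Fin n) (Fin n × Fin n) ℂ)
    (hU : ∀ k₁ k₂, S k₁ k₂ * S21 S k₂ k₁ = 1)
    (hYB : ∀ k₁ k₂ k₃,
      leg12 (S k₁ k₂) * leg13 (S k₁ k₃) * leg23 (S k₂ k₃) =
        leg23 (S k₂ k₃) * leg13 (S k₁ k₃) * leg12 (S k₁ k₂))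
    (𝒜 : Type*) [Ring 𝒜] [Algebra ℂ 𝒜]
    (a ad : ℝ → Fin n → 𝒜)
    (t r : ℝ → Matrix (Fin n) (Fin n) 𝒜)
    (hZF1 : ∀ k₁ k₂ (i j : Fin n), a k₁ i * a k₂ j =
      ∑ p, ∑ q, S21 S k₂ k₁ (i, j) (p, q) • (a k₂ q * a k₁ p))
    (hZF2 : ∀ k₁ k₂ (i j : Fin n), ad k₁ i * ad k₂ j =
      ∑ p, ∑ q, S21 S k₂ k₁ (p, q) (i, j) • (ad k₂ q * ad k₁ p))
    (hE1 : ∀ k₁ k₂ (i j l : Fin n), a k₁ i * t k₂ j l =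
      ∑ q, ∑ r', ∑ s, ∑ m,
        (S21 S k₂ k₁ (i, j) (r', q) * S k₁ k₂ (r', s) (m, l)) • (t k₂ q s * a k₁ m))
    (hE2 : ∀ k₁ k₂ (i j l : Fin n), a k₁ i * r k₂ j l =
      ∑ q, ∑ r', ∑ s, ∑ m,
        (S21 S k₂ k₁ (i, j) (r', q) * S k₁ (-k₂) (r', s) (m, l)) • (r k₂ q s * a k₁ m))
    (hE3 : ∀ k₁ k₂ (i l j : Fin n), t k₁ i l * ad k₂ j =
      ∑ p, ∑ q, ∑ r', ∑ s,
        (S k₁ k₂ (i, p) (q, r') * S21 S k₂ k₁ (s, r') (l, j)) • (ad k₂ p * t k₁ q s))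
    (hE4 : ∀ k₁ k₂ (i l j : Fin n), r k₁ i l * ad k₂ j =
      ∑ p, ∑ q, ∑ r', ∑ s,
        (S k₁ k₂ (i, p) (q, r') * S21 S k₂ (-k₁) (s, r') (l, j)) • (ad k₂ p * r k₁ q s))
    (hE5 : ∀ k₁ k₂,
      emb 𝒜 (S k₁ k₂) * leg1 (t k₁) * emb 𝒜 (S21 S k₂ k₁) * leg2 (t k₂) =
        leg2 (t k₂) * emb 𝒜 (S k₁ k₂) * leg1 (t k₁) * emb 𝒜 (S21 S k₂ k₁))
    (hE6 : ∀ k₁ k₂,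
      emb 𝒜 (S k₁ k₂) * leg1 (t k₁) * emb 𝒜 (S21 S k₂ k₁) * leg2 (r k₂) =
        leg2 (r k₂) * emb 𝒜 (S k₁ (-k₂)) * leg1 (t k₁) * emb 𝒜 (S21 S (-k₂) k₁))
    (hE7 : ∀ k₁ k₂,
      emb 𝒜 (S k₁ k₂) * leg1 (r k₁) * emb 𝒜 (S21 S k₂ (-k₁)) * leg2 (r k₂) =
        leg2 (r k₂) * emb 𝒜 (S k₁ (-k₂)) * leg1 (r k₁) * emb 𝒜 (S21 S (-k₂) (-k₁)))
    (hE8 : ∀ k, t k * t k + r k * r (-k) = 1)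
    (hE9 : ∀ k, t k * r k + r k * t (-k) = 0)
    (al ald A Ad : ℝ → Fin n → 𝒜)
    (hal : ∀ k (i : Fin n), al k i = ∑ j, (t k i j * a k j + r k i j * a (-k) j))
    (hald : ∀ k (i : Fin n), ald k i = ∑ j, (ad k j * t k j i + ad (-k) j * r (-k) j i))
    (hA : ∀ k (i : Fin n), A k i = (2 : ℂ)⁻¹ • (a k i + al k i))
    (hAd : ∀ k (i : Fin n), Ad k i = (2 : ℂ)⁻¹ • (ad k i + ald k i))
    :
    ∀ k₁ k₂ (i l j : Fin n),
      (t k₁ i l * Ad k₂ j =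
        ∑ p, ∑ q, ∑ r', ∑ s,
          (S k₁ k₂ (i, p) (q, r') * S21 S k₂ k₁ (s, r') (l, j)) • (Ad k₂ p * t k₁ q s)) ∧
      (r k₁ i l * Ad k₂ j =
        ∑ p, ∑ q, ∑ r', ∑ s,
          (S k₁ k₂ (i, p) (q, r') * S21 S k₂ (-k₁) (s, r') (l, j)) • (Ad k₂ p * r k₁ q s)) := by
  have hAd' (k : ℝ) :
      Ad k = (2 : ℂ)⁻¹ • (ad k + (ad k ᵥ* t k + ad (-k) ᵥ* r (-k))) := by
    funext i
    simp [hAd, hald, Matrix.vecMul, dotProduct, Finset.sum_add_distrib]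
  intro k₁ k₂ i l j
  constructor
  · revert i l j
    rw [exchange_iff, hAd']
    refine exchange_symmetrized ((exchange_iff _ _ _ _).1 (hE3 k₁ k₂))
      ((exchange_iff _ _ _ _).1 (hE3 k₁ (-k₂))) ?_ ?_ _
    · simpa only [Matrix.mul_assoc] using hE5 k₁ k₂
    · simpa only [Matrix.mul_assoc, neg_neg] using hE6 k₁ (-k₂)
  · revert i l j
    rw [exchange_iff, hAd']
    refine exchange_symmetrized ((exchange_iff _ _ _ _).1 (hE4 k₁ k₂))
      ((exchange_iff _ _ _ _).1 (hE4 k₁ (-k₂))) ?_ ?_ _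
    · exact reflection_transmission_exchange hU hE6 k₁ k₂
    · simpa only [Matrix.mul_assoc, neg_neg] using hE7 k₁ (-k₂)
end

section
/- (Reflection–transmission identities for the symmetrized generators: the reflection–transmission automorphism is the identity on them.) For all k ∈ ℝ and every index i: A_i(k) = Σ_j (t_{ij}(k)A_j(k) + r_{ij}(k)A_j(−k)) and A†_i(k) = Σ_j (A†_j(k)t_{ji}(k) + A†_j(−k)r_{ji}(−k)). -/
open scoped Matrix BigOperators

variable {n : ℕ}

/-- If `t² + r r' = 1` and `t r + r t' = 0`, then the reflection–transmission map
`(x, y) ↦ t x + r y` sends the image of `(x, y)` under its two components back to `x`. -/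
theorem Matrix.mulVec_reflection_transmission {R ι : Type*} [Ring R] [Fintype ι] [DecidableEq ι]
    {t r t' r' : Matrix ι ι R} (h₁ : t * t + r * r' = 1) (h₂ : t * r + r * t' = 0)
    (x y : ι → R) :
    t *ᵥ (t *ᵥ x + r *ᵥ y) + r *ᵥ (t' *ᵥ y + r' *ᵥ x) = x := by
  calc _ = (t * t + r * r') *ᵥ x + (t * r + r * t') *ᵥ y := by
        simp only [Matrix.mulVec_add, Matrix.add_mulVec, Matrix.mulVec_mulVec]
        abel
    _ = x := by rw [h₁, h₂, Matrix.one_mulVec, Matrix.zero_mulVec, add_zero]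

/-- Row-vector version of `Matrix.mulVec_reflection_transmission`. -/
theorem Matrix.vecMul_reflection_transmission {R ι : Type*} [Ring R] [Fintype ι] [DecidableEq ι]
    {t r t' r' : Matrix ι ι R} (h₁ : t * t + r * r' = 1) (h₂ : t' * r' + r' * t = 0)
    (x y : ι → R) :
    (x ᵥ* t + y ᵥ* r') ᵥ* t + (y ᵥ* t' + x ᵥ* r) ᵥ* r' = x := by
  calc _ = x ᵥ* (t * t + r * r') + y ᵥ* (t' * r' + r' * t) := by
        simp only [Matrix.add_vecMul, Matrix.vecMul_add, Matrix.vecMul_vecMul]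
        abel
    _ = x := by rw [h₁, h₂, Matrix.vecMul_one, Matrix.vecMul_zero, add_zero]

theorem stmt_16
    (hn : 1 ≤ n)
    (𝒜 : Type*) [Ring 𝒜] [Algebra ℂ 𝒜]
    (a ad : ℝ → Fin n → 𝒜)
    (t r : ℝ → Matrix (Fin n) (Fin n) 𝒜)
    (hE8 : ∀ k, t k * t k + r k * r (-k) = 1)
    (hE9 : ∀ k, t k * r k + r k * t (-k) = 0)
    (al ald A Ad : ℝ → Fin n → 𝒜)
    (hal : ∀ k (i : Fin n), al k i = ∑ j, (t k i j * a k j + r k i j * a (-k) j))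
    (hald : ∀ k (i : Fin n), ald k i = ∑ j, (ad k j * t k j i + ad (-k) j * r (-k) j i))
    (hA : ∀ k (i : Fin n), A k i = (2 : ℂ)⁻¹ • (a k i + al k i))
    (hAd : ∀ k (i : Fin n), Ad k i = (2 : ℂ)⁻¹ • (ad k i + ald k i))
    :
    ∀ k (i : Fin n),
      (A k i = ∑ j, (t k i j * A k j + r k i j * A (-k) j)) ∧
      (Ad k i = ∑ j, (Ad k j * t k j i + Ad (-k) j * r (-k) j i)) := by
  have hal' (k : ℝ) : al k = t k *ᵥ a k + r k *ᵥ a (-k) := by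
    ext i
    simp [hal, Matrix.mulVec, dotProduct, Finset.sum_add_distrib]
  have hald' (k : ℝ) : ald k = ad k ᵥ* t k + ad (-k) ᵥ* r (-k) := by
    ext i
    simp [hald, Matrix.vecMul, dotProduct, Finset.sum_add_distrib]
  have hA' (k : ℝ) : A k = (2 : ℂ)⁻¹ • (a k + al k) := funext (hA k)
  have hAd' (k : ℝ) : Ad k = (2 : ℂ)⁻¹ • (ad k + ald k) := funext (hAd k)
  intro k i
  have hinv : t k *ᵥ al k + r k *ᵥ al (-k) = a k := by
    rw [hal' k, hal' (-k), neg_neg]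
    exact Matrix.mulVec_reflection_transmission (hE8 k) (hE9 k) _ _
  have hinvd : ald k ᵥ* t k + ald (-k) ᵥ* r (-k) = ad k := by
    have h := hE9 (-k)
    rw [neg_neg] at h
    rw [hald' k, hald' (-k), neg_neg]
    exact Matrix.vecMul_reflection_transmission (hE8 k) h _ _
  constructor
  · have h : A k = t k *ᵥ A k + r k *ᵥ A (-k) := by
      rw [hA' k, hA' (-k), Matrix.mulVec_smul, Matrix.mulVec_smul, ← smul_add,
        Matrix.mulVec_add, Matrix.mulVec_add, add_add_add_comm, hinv, ← hal' k, add_comm]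
    simpa [Matrix.mulVec, dotProduct, Finset.sum_add_distrib] using congrFun h i
  · have h : Ad k = Ad k ᵥ* t k + Ad (-k) ᵥ* r (-k) := by
      rw [hAd' k, hAd' (-k), Matrix.smul_vecMul, Matrix.smul_vecMul, ← smul_add,
        Matrix.add_vecMul, Matrix.add_vecMul, add_add_add_comm, hinvd, ← hald' k, add_comm]
    simpa [Matrix.vecMul, dotProduct, Finset.sum_add_distrib] using congrFun h i
end

section
/- (Pointwise identity underlying the invariance of the even Hamiltonians, eq. (19): the symmetrized number density of the ρ-transformed generators equals that of the original generators.) For every k ∈ ℝ: Σ_i (α†_i(k)α_i(k) + α†_i(−k)α_i(−k)) = Σ_i (a†_i(k)a_i(k) + a†_i(−k)a_i(−k)). -/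
open scoped Matrix BigOperators

variable {n : ℕ}

open Matrix in
/-- A block matrix `[[t, r], [r', t']]` squaring to the identity preserves the sum of the pairings
of row vectors `x, x'` with column vectors `y, y'`. -/
theorem dotProduct_add_dotProduct_of_block_sq_eq_one {ι R : Type*} [Fintype ι] [DecidableEq ι]
    [Ring R] (x x' y y' : ι → R) (t t' r r' : Matrix ι ι R)
    (h : t * t + r * r' = 1) (h' : t' * t' + r' * r = 1)
    (h₀ : t * r + r * t' = 0) (h₀' : t' * r' + r' * t = 0) :
    (x ᵥ* t + x' ᵥ* r') ⬝ᵥ (t *ᵥ y + r *ᵥ y') + (x' ᵥ* t' + x ᵥ* r) ⬝ᵥ (t' *ᵥ y' + r' *ᵥ y) =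
      x ⬝ᵥ y + x' ⬝ᵥ y' := by
  have e : x ⬝ᵥ ((t * t + r * r') *ᵥ y) + x' ⬝ᵥ ((t' * t' + r' * r) *ᵥ y') +
      x ⬝ᵥ ((t * r + r * t') *ᵥ y') + x' ⬝ᵥ ((t' * r' + r' * t) *ᵥ y) =
      x ⬝ᵥ y + x' ⬝ᵥ y' := by
    simp [h, h', h₀, h₀']
  rw [← e]
  simp only [add_dotProduct, dotProduct_add, add_mulVec, ← dotProduct_mulVec, mulVec_mulVec]
  abel

theorem stmt_17
    (hn : 1 ≤ n)
    (𝒜 : Type*) [Ring 𝒜] [Algebra ℂ 𝒜]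
    (a ad : ℝ → Fin n → 𝒜)
    (t r : ℝ → Matrix (Fin n) (Fin n) 𝒜)
    (hE8 : ∀ k, t k * t k + r k * r (-k) = 1)
    (hE9 : ∀ k, t k * r k + r k * t (-k) = 0)
    (al ald A Ad : ℝ → Fin n → 𝒜)
    (hal : ∀ k (i : Fin n), al k i = ∑ j, (t k i j * a k j + r k i j * a (-k) j))
    (hald : ∀ k (i : Fin n), ald k i = ∑ j, (ad k j * t k j i + ad (-k) j * r (-k) j i))
    (hA : ∀ k (i : Fin n), A k i = (2 : ℂ)⁻¹ • (a k i + al k i))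
    (hAd : ∀ k (i : Fin n), Ad k i = (2 : ℂ)⁻¹ • (ad k i + ald k i))
    :
    ∀ k : ℝ,
      ∑ i, (ald k i * al k i + ald (-k) i * al (-k) i) =
        ∑ i, (ad k i * a k i + ad (-k) i * a (-k) i) := by
  intro k
  have hal' (k : ℝ) : al k = t k *ᵥ a k + r k *ᵥ a (-k) := by
    ext i
    simp [hal, Matrix.mulVec, dotProduct, Finset.sum_add_distrib]
  have hald' (k : ℝ) : ald k = ad k ᵥ* t k + ad (-k) ᵥ* r (-k) := by
    ext i
    simp [hald, Matrix.vecMul, dotProduct, Finset.sum_add_distrib]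
  have h := dotProduct_add_dotProduct_of_block_sq_eq_one (ad k) (ad (-k)) (a k) (a (-k))
    (t k) (t (-k)) (r k) (r (-k)) (hE8 k) (by simpa using hE8 (-k)) (hE9 k)
    (by simpa using hE9 (-k))
  have hal_neg := hal' (-k)
  have hald_neg := hald' (-k)
  rw [neg_neg] at hal_neg hald_neg
  rw [← hal', ← hald', ← hal_neg, ← hald_neg] at h
  simpa only [dotProduct, Finset.sum_add_distrib] using h
end

section
/- (Hopf-coideal property: the comultiplication of the dressed reflection and transmission matrices, as in the final Proposition.) Let H be a bialgebra over ℂ with comultiplication Δ, let L : ℝ → Mₙ(H) with each L(k) invertible and satisfying Δ(L_{ab}(k)) = Σ_{x} L_{ax}(k) ⊗ L_{xb}(k) for all a,b and all k ∈ ℝ, and let T, R : ℝ → Mₙ(ℂ) (scalar matrices, embedded in Mₙ(H) via c ↦ c·1). Define t(k) = L(k)T(k)L(k)⁻¹ and r(k) = L(k)R(k)L(−k)⁻¹ in Mₙ(H). Then for all k ∈ ℝ and all a,b: Δ(t_{ab}(k)) = Σ_{x,y} L_{ax}(k)(L(k)⁻¹)_{yb} ⊗ t_{xy}(k) and Δ(r_{ab}(k))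 = Σ_{x,y} L_{ax}(k)(L(−k)⁻¹)_{yb} ⊗ r_{xy}(k); in particular the entries of t(k) and r(k) generate a left coideal of H. -/
open scoped TensorProduct BigOperators

section Comultiplication

variable {ι H : Type*} [Fintype ι] [Ring H] [Bialgebra ℂ H]

/-- A matrix `L` whose entries are comultiplied by matrix multiplication satisfies
`Δ L = (L ⊗ 1) (1 ⊗ L)`. -/
theorem map_comul_eq_mul (L : Matrix ι ι H)
    (hΔ : ∀ a b, Bialgebra.comulAlgHom ℂ H (L a b) = ∑ x, L a x ⊗ₜ[ℂ] L x b) :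
    L.map (Bialgebra.comulAlgHom ℂ H) =
      L.map (Algebra.TensorProduct.includeLeft : H →ₐ[ℂ] H ⊗[ℂ] H) *
        L.map (Algebra.TensorProduct.includeRight : H →ₐ[ℂ] H ⊗[ℂ] H) := by
  ext a b
  rw [Matrix.map_apply, hΔ, Matrix.mul_apply]
  simp

variable [DecidableEq ι]

/-- The inverse of a matrix with `Δ L = (L ⊗ 1) (1 ⊗ L)` satisfies
`Δ L⁻¹ = (1 ⊗ L⁻¹) (L⁻¹ ⊗ 1)`. -/
theorem map_comul_inv_eq_mul (L Linv : Matrix ι ι H) (h₁ : L * Linv = 1) (h₂ : Linv * L = 1)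
    (hΔ : ∀ a b, Bialgebra.comulAlgHom ℂ H (L a b) = ∑ x, L a x ⊗ₜ[ℂ] L x b) :
    Linv.map (Bialgebra.comulAlgHom ℂ H) =
      Linv.map (Algebra.TensorProduct.includeRight : H →ₐ[ℂ] H ⊗[ℂ] H) *
        Linv.map (Algebra.TensorProduct.includeLeft : H →ₐ[ℂ] H ⊗[ℂ] H) := by
  have map_mul_eq_one (f : H →ₐ[ℂ] H ⊗[ℂ] H) {A B : Matrix ι ι H} (h : A * B = 1) :
      A.map f * B.map f = 1 := by
    rw [← Matrix.map_mul, h, Matrix.map_one f (map_zero f) (map_one f)]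
  refine left_inv_eq_right_inv (map_mul_eq_one _ h₂) ?_
  rw [map_comul_eq_mul L hΔ, Matrix.mul_assoc, ← Matrix.mul_assoc (L.map _) (Linv.map _),
    map_mul_eq_one _ h₁, Matrix.one_mul, map_mul_eq_one _ h₁]

/-- Comultiplication of a scalar matrix `K` dressed as `L K M⁻¹`. -/
theorem comul_dressed_apply (L M Minv : Matrix ι ι H) (h₁ : M * Minv = 1) (h₂ : Minv * M = 1)
    (hL : ∀ a b, Bialgebra.comulAlgHom ℂ H (L a b) = ∑ x, L a x ⊗ₜ[ℂ] L x b)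
    (hM : ∀ a b, Bialgebra.comulAlgHom ℂ H (M a b) = ∑ x, M a x ⊗ₜ[ℂ] M x b)
    (K : Matrix ι ι ℂ) (a b : ι) :
    Bialgebra.comulAlgHom ℂ H ((L * K.map (algebraMap ℂ H) * Minv) a b) =
      ∑ x, ∑ y, (L a x * Minv y b) ⊗ₜ[ℂ] (L * K.map (algebraMap ℂ H) * Minv) x y := by
  have map_scalar (f : H →ₐ[ℂ] H ⊗[ℂ] H) :
      (K.map (algebraMap ℂ H)).map f = K.map (algebraMap ℂ (H ⊗[ℂ] H)) := by
    ext i j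
    exact f.commutes (K i j)
  have h : (L * K.map (algebraMap ℂ H) * Minv).map (Bialgebra.comulAlgHom ℂ H) =
      L.map (Algebra.TensorProduct.includeLeft : H →ₐ[ℂ] H ⊗[ℂ] H) *
        ((L * K.map (algebraMap ℂ H) * Minv).map
          (Algebra.TensorProduct.includeRight : H →ₐ[ℂ] H ⊗[ℂ] H) *
        Minv.map (Algebra.TensorProduct.includeLeft : H →ₐ[ℂ] H ⊗[ℂ] H)) := by
    simp only [Matrix.map_mul, map_scalar, map_comul_eq_mul L hL,
      map_comul_inv_eq_mul M Minv h₁ h₂ hM, Matrix.mul_assoc]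
  rw [← Matrix.map_apply (f := Bialgebra.comulAlgHom ℂ H), h, Matrix.mul_apply]
  refine Finset.sum_congr rfl fun x _ => ?_
  rw [Matrix.mul_apply, Finset.mul_sum]
  refine Finset.sum_congr rfl fun y _ => ?_
  simp only [Matrix.map_apply, Algebra.TensorProduct.includeLeft_apply,
    Algebra.TensorProduct.includeRight_apply, Algebra.TensorProduct.tmul_mul_tmul, one_mul, mul_one]

end Comultiplication

theorem stmt_19 (n : ℕ) (hn : 1 ≤ n)
    (H : Type*) [Ring H] [Bialgebra ℂ H]
    (L Linv : ℝ → Matrix (Fin n) (Fin n) H)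
    (hL1 : ∀ k, L k * Linv k = 1) (hL2 : ∀ k, Linv k * L k = 1)
    (hΔL : ∀ k (a b : Fin n),
      Bialgebra.comulAlgHom ℂ H (L k a b) = ∑ x, L k a x ⊗ₜ[ℂ] L k x b)
    (T R : ℝ → Matrix (Fin n) (Fin n) ℂ)
    (t r : ℝ → Matrix (Fin n) (Fin n) H)
    (ht : ∀ k, t k = L k * (T k).map (algebraMap ℂ H) * Linv k)
    (hr : ∀ k, r k = L k * (R k).map (algebraMap ℂ H) * Linv (-k)) :
    ∀ k (a b : Fin n),
      (Bialgebra.comulAlgHom ℂ H (t k a b) =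
        ∑ x, ∑ y, (L k a x * Linv k y b) ⊗ₜ[ℂ] t k x y) ∧
      (Bialgebra.comulAlgHom ℂ H (r k a b) =
        ∑ x, ∑ y, (L k a x * Linv (-k) y b) ⊗ₜ[ℂ] r k x y) := by
  intro k a b
  rw [ht, hr]
  exact ⟨comul_dressed_apply _ _ _ (hL1 k) (hL2 k) (hΔL k) (hΔL k) _ a b,
    comul_dressed_apply _ _ _ (hL1 (-k)) (hL2 (-k)) (hΔL k) (hΔL (-k)) _ a b⟩
end
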